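/- For every integer s ≥ 3, there does not exist an ((s+1)², s+3, 2s+1)-suitable core. (Combined with Colbourn's construction of an ((s+1)², s+2, 2s+1)-suitable core, this shows SCN(2s+1, (s+1)²) = s+2 for all s ≥ 3.) -/

import Mathlib

/-- An `(N,v,t)`-suitable core: an `N × v` array, each of whose rows is a
permutation of `{1,…,v}` (modelled as `Fin v`, with `C i p` the symbol in
position `p` of row `i`), such that for every `s` with `0 ≤ s ≤ t-1`, every
symbol precedes every subset of `s` other symbols in at least `t - s` rows. -/
def IsSuitableCore (N v t : ℕ) (C : Fin N → Equiv.Perm (Fin v)) : Prop :=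
  ∀ s : ℕ, s < t → ∀ σ : Fin v, ∀ S : Finset (Fin v), σ ∉ S → S.card = s →
    t - s ≤ (Finset.univ.filter
      (fun i : Fin N => ∀ τ ∈ S, ((C i).symm σ : ℕ) < ((C i).symm τ : ℕ))).card

open Finset in
theorem core_abstract {V I : Type*} [Fintype V] [DecidableEq V] [Fintype I] [DecidableEq I]
    (s : ℕ) (hs : 3 ≤ s) (hV : Fintype.card V = s + 3) (hI : Fintype.card I = (s + 1) ^ 2)
    (F G H : I → V) (hFG : ∀ i, F i ≠ G i)
    (h : ∀ (σ : V) (T : Finset V), σ ∉ T → T.card ≤ 3 →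
      s - 1 + T.card ≤ (univ.filter (fun i => F i = σ ∨ (F i ∈ T ∧ (G i = σ ∨
        (G i ∈ T ∧ (H i = σ ∨ H i ∈ T)))))).card)
    (hFH : ∀ i, F i ≠ H i) (hGH : ∀ i, G i ≠ H i) : False := by
  classical
  obtain ⟨a, ha⟩ : ∃ a : V → ℕ, a = fun σ => (univ.filter (fun i => F i = σ)).card := ⟨_, rfl⟩
  obtain ⟨b, hb⟩ : ∃ b : V → V → ℕ,
    b = fun x y => (univ.filter (fun i => F i = x ∧ G i = y)).card := ⟨_, rfl⟩
  obtain ⟨c, hc⟩ : ∃ c : V → V → V → ℕ,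
    c = fun x y z => (univ.filter (fun i => F i = x ∧ G i = y ∧ H i = z)).card := ⟨_, rfl⟩
  have h0 : ∀ σ, s - 1 ≤ a σ := by
    intro σ
    have := h σ ∅ (by simp) (by simp)
    simpa [ha] using this
  have h1 : ∀ σ x, σ ≠ x → s ≤ a σ + b x σ := by
    intro σ x hx
    have h1 := h σ {x} (by simpa using hx) (by simp)
    have h2 : (univ.filter (fun i => F i = σ ∨ (F i ∈ ({x} : Finset V) ∧ (G i = σ ∨
        (G i ∈ ({x} : Finset V) ∧ (H i = σ ∨ H i ∈ ({x} : Finset V))))))) ⊆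
        univ.filter (fun i => F i = σ) ∪ univ.filter (fun i => F i = x ∧ G i = σ) := by
      intro i
      have := hFG i
      simp only [mem_filter, mem_univ, true_and, mem_union, mem_singleton]
      grind
    have h3 := (card_le_card h2).trans (card_union_le _ _)
    simp only [card_singleton] at h1
    simp only [ha, hb]
    omega
  have h2 : ∀ σ x y, σ ≠ x → σ ≠ y → x ≠ y →
      s + 1 ≤ a σ + b x σ + b y σ + c x y σ + c y x σ := by
    intro σ x y hx hy hxy
    have h1 := h σ {x, y} (by simp [hx, hy]) (by simp [card_pair hxy])
    have h2 : (univ.filter (fun i => F i = σ ∨ (F i ∈ ({x, y} : Finset V) ∧ (G i = σ ∨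
        (G i ∈ ({x, y} : Finset V) ∧ (H i = σ ∨ H i ∈ ({x, y} : Finset V))))))) ⊆
        univ.filter (fun i => F i = σ) ∪ univ.filter (fun i => F i = x ∧ G i = σ)
        ∪ univ.filter (fun i => F i = y ∧ G i = σ)
        ∪ univ.filter (fun i => F i = x ∧ G i = y ∧ H i = σ)
        ∪ univ.filter (fun i => F i = y ∧ G i = x ∧ H i = σ) := by
      intro i
      have := hFG i
      have := hFH i
      have := hGH i
      simp only [mem_filter, mem_univ, true_and, mem_union, mem_singleton, mem_insert]
      grind
    have h3 := (card_le_card h2).trans (card_union_le _ _)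
    have h4 := card_union_le (univ.filter (fun i => F i = σ) ∪ univ.filter (fun i => F i = x ∧ G i = σ)
        ∪ univ.filter (fun i => F i = y ∧ G i = σ)) (univ.filter (fun i => F i = x ∧ G i = y ∧ H i = σ))
    have h5 := card_union_le (univ.filter (fun i => F i = σ) ∪ univ.filter (fun i => F i = x ∧ G i = σ))
        (univ.filter (fun i => F i = y ∧ G i = σ))
    have h6 := card_union_le (univ.filter (fun i => F i = σ)) (univ.filter (fun i => F i = x ∧ G i = σ))
    rw [card_pair hxy] at h1
    simp only [ha, hb, hc]
    omega
  have suma : ∑ x, a x = (s + 1) ^ 2 := by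
    rw [← hI, ← card_univ, card_eq_sum_card_fiberwise (f := F) (t := univ) (by simp), ha]
  have sumb : ∀ x, ∑ y, b x y = a x := by
    intro x
    simp only [ha, hb]
    rw [card_eq_sum_card_fiberwise (f := G) (t := univ) (by simp)]
    simp only [filter_filter]
  have sumc : ∀ x y, ∑ z, c x y z = b x y := by
    intro x y
    simp only [hb, hc]
    rw [card_eq_sum_card_fiberwise (f := H) (t := univ) (by simp)]
    simp only [filter_filter, and_assoc]
  have bxx : ∀ x, b x x = 0 := by
    intro x
    simp only [hb, card_eq_zero, filter_eq_empty_iff]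
    intro i _ h
    exact hFG i (h.1.trans h.2.symm)
  have sumcall : ∑ x, ∑ y, ∑ z, c x y z = (s + 1) ^ 2 := by
    simp only [sumc, sumb, suma]
  obtain ⟨Z, hZ⟩ : ∃ Z : Finset V, Z = univ.filter (fun x => a x = s - 1) := ⟨_, rfl⟩
  have mZ : ∀ x, x ∈ Z ↔ a x = s - 1 := by simp [hZ]
  have cardP : Zᶜ.card = s + 3 - Z.card := by rw [card_compl, hV]
  have hZle : Z.card ≤ s + 3 := hV ▸ card_le_univ Z
  have hP : ∀ x ∈ Zᶜ, s ≤ a x := by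
    intro x hx
    rw [mem_compl, mZ] at hx
    have := h0 x
    omega
  have split : ∑ x ∈ Z, a x + ∑ x ∈ Zᶜ, a x = (s + 1) ^ 2 := by
    rw [sum_add_sum_compl, suma]
  have sumZ : ∑ x ∈ Z, a x = Z.card * (s - 1) := by
    rw [sum_congr rfl (fun x hx => (mZ x).1 hx)]; simp
  have sumPge : Zᶜ.card * s ≤ ∑ x ∈ Zᶜ, a x := by
    have := card_nsmul_le_sum Zᶜ a s hP
    simpa using this
  have bZ : ∀ x, ∀ y ∈ Z, y ≠ x → 1 ≤ b x y := by
    intro x y hy hyx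
    have := h1 y x hyx
    rw [mZ] at hy
    omega
  have bZsum : ∀ x, (Z.erase x).card ≤ ∑ y ∈ Z, b x y := by
    intro x
    calc (Z.erase x).card = ∑ y ∈ Z.erase x, 1 := by simp
      _ ≤ ∑ y ∈ Z.erase x, b x y := sum_le_sum (fun y hy => by
          rw [mem_erase] at hy; exact bZ x y hy.2 hy.1)
      _ ≤ ∑ y ∈ Z, b x y := sum_le_sum_of_subset (erase_subset _ _)
  have bsplit : ∀ x, ∑ y ∈ Z, b x y + ∑ y ∈ Zᶜ, b x y = a x := by
    intro x; rw [sum_add_sum_compl, sumb]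
  obtain ⟨r, rfl⟩ : ∃ r, s = r + 1 := ⟨s - 1, by omega⟩
  simp only [Nat.add_sub_cancel] at *
  have hZlo : r ≤ Z.card := by
    by_contra hlt
    rw [cardP] at sumPge
    obtain ⟨k, hk⟩ : ∃ k, r + 1 + 3 - Z.card = k := ⟨_, rfl⟩
    have : Z.card = r + 4 - k := by omega
    have e : Z.card + k = r + 4 := by omega
    have : 5 ≤ k := by omega
    rw [hk] at sumPge
    nlinarith
  have hZhi : Z.card ≤ r + 1 := by
    obtain ⟨x, hx⟩ : Z.Nonempty := card_pos.1 (by omega)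
    have h1 := bZsum x
    have h2 := bsplit x
    rw [card_erase_of_mem hx] at h1
    have := (mZ x).1 hx
    omega
  obtain hcard | hcard : Z.card = r ∨ Z.card = r + 1 := by omega
  · have hPc : Zᶜ.card = 4 := by omega
    have hPa : ∀ p ∈ Zᶜ, a p = r + 1 := by
      have e : ∑ x ∈ Zᶜ, (r + 1) = ∑ x ∈ Zᶜ, a x := by
        rw [sum_const, hPc, smul_eq_mul]
        rw [sumZ, hcard] at split
        nlinarith
      intro p hp
      exact (((sum_eq_sum_iff_of_le hP).1 e) p hp).symm
    have hU : ∀ x, ∑ y ∈ Zᶜ, b x y ≤ 1 := by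
      intro x
      have h1 := bZsum x
      have h2 := bsplit x
      by_cases hx : x ∈ Z
      · rw [card_erase_of_mem hx] at h1
        have := (mZ x).1 hx
        omega
      · rw [erase_eq_of_notMem hx] at h1
        have := hPa x (mem_compl.2 hx)
        omega
    have hUall : ∑ q ∈ Zᶜ, ∑ x, b x q ≤ r + 4 := by
      rw [sum_comm]
      calc _ ≤ ∑ x : V, 1 := sum_le_sum (fun x _ => hU x)
        _ = r + 4 := by simp [hV]
    obtain ⟨D, hD⟩ : ∃ D : V → Finset V, D = fun q => univ.filter (fun x => x ≠ q ∧ b x q = 0) :=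
      ⟨_, rfl⟩
    have hDcard : ∀ q, r + 3 ≤ (D q).card + ∑ x, b x q := by
      intro q
      have e1 : (univ.erase q).card = r + 3 := by
        rw [card_erase_of_mem (mem_univ _), card_univ, hV]; omega
      have e2 : univ.erase q ⊆ D q ∪ univ.filter (fun x => 1 ≤ b x q) := by
        intro x
        simp only [hD, mem_erase, mem_univ, mem_union, mem_filter, true_and]
        intro hx
        have : b x q = 0 ∨ 1 ≤ b x q := by omega
        tauto
      have e3 := (card_le_card e2).trans (card_union_le _ _)
      have e4 : (univ.filter (fun x => 1 ≤ b x q)).card ≤ ∑ x, b x q := by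
        rw [card_filter]
        apply sum_le_sum
        intro x _
        split_ifs <;> omega
      omega
    have hDsum : 3 * (r + 1) + 5 ≤ ∑ q ∈ Zᶜ, (D q).card := by
      have := sum_le_sum (fun q (_ : q ∈ Zᶜ) => hDcard q)
      rw [sum_const, hPc, sum_add_distrib, smul_eq_mul] at this
      omega
    have hDq : ∀ q ∈ Zᶜ, (D q).card * (D q).card ≤ 2 * (∑ x, ∑ y, c x y q) + (D q).card := by
      intro q hq
      have e0 : (D q).offDiag.card + (D q).card = (D q).card * (D q).card := by
        rw [offDiag_card]
        have : (D q).card ≤ (D q).card * (D q).card := Nat.le_mul_self _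
        omega
      have e1 : (D q).offDiag.card ≤ ∑ w ∈ (D q).offDiag, (c w.1 w.2 q + c w.2 w.1 q) := by
        rw [card_eq_sum_ones]
        apply sum_le_sum
        rintro ⟨x, y⟩ hw
        simp only [mem_offDiag, hD, mem_filter, mem_univ, true_and] at hw
        have := h2 q x y hw.1.1.symm hw.2.1.1.symm hw.2.2
        have := hPa q hq
        change 1 ≤ c x y q + c y x q
        omega
      have e2 : ∑ w ∈ (D q).offDiag, (c w.1 w.2 q + c w.2 w.1 q) ≤
          ∑ w : V × V, (c w.1 w.2 q + c w.2 w.1 q) := sum_le_sum_of_subset (subset_univ _)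
      have e3 : ∑ w : V × V, (c w.1 w.2 q + c w.2 w.1 q) = 2 * (∑ x, ∑ y, c x y q) := by
        rw [sum_add_distrib, Fintype.sum_prod_type, Fintype.sum_prod_type_right, two_mul]
      omega
    have hS := sum_le_sum hDq
    rw [sum_add_distrib, ← mul_sum] at hS
    have hS2 : ∑ q ∈ Zᶜ, ∑ x, ∑ y, c x y q ≤ (r + 1 + 1) ^ 2 := by
      rw [← sumcall]
      calc ∑ q ∈ Zᶜ, ∑ x, ∑ y, c x y q ≤ ∑ q, ∑ x, ∑ y, c x y q :=
            sum_le_sum_of_subset (subset_univ _)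
        _ = ∑ x, ∑ y, ∑ z, c x y z := by
            rw [sum_comm]
            exact sum_congr rfl (fun x _ => sum_comm)
    have hCS := sq_sum_le_card_mul_sum_sq (s := Zᶜ) (f := fun q => (D q).card)
    rw [hPc] at hCS
    simp only [sq] at hCS
    obtain ⟨d, hd⟩ : ∃ d, ∑ q ∈ Zᶜ, (D q).card = d := ⟨_, rfl⟩
    rw [hd] at hCS hDsum hS
    obtain ⟨k, rfl⟩ := Nat.exists_eq_add_of_le hDsum
    nlinarith
  · have hPc : Zᶜ.card = 3 := by omega
    have hPsum : ∑ x ∈ Zᶜ, a x = 3 * (r + 1) + 1 := by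
      rw [sumZ, hcard] at split
      nlinarith
    obtain ⟨p0, p, p', hp1, hp2, hp3, ap0, ap, ap', hPm⟩ : ∃ p0 p p' : V, p0 ≠ p ∧ p0 ≠ p' ∧ p ≠ p' ∧
        a p0 = r + 2 ∧ a p = r + 1 ∧ a p' = r + 1 ∧ (p0 ∉ Z ∧ p ∉ Z ∧ p' ∉ Z) := by
      obtain ⟨x, y, z, hxy, hxz, hyz, e⟩ := card_eq_three.1 hPc
      have hx := hP x (by simp [e])
      have hy := hP y (by simp [e])
      have hz := hP z (by simp [e])
      have mx : x ∉ Z := by rw [← mem_compl]; simp [e]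
      have my : y ∉ Z := by rw [← mem_compl]; simp [e]
      have mz : z ∉ Z := by rw [← mem_compl]; simp [e]
      rw [e, sum_insert (by simp [hxy, hxz]), sum_pair hyz] at hPsum
      have : a x = r + 2 ∨ a y = r + 2 ∨ a z = r + 2 := by omega
      rcases this with h | h | h
      · exact ⟨x, y, z, hxy, hxz, hyz, h, by omega, by omega, mx, my, mz⟩
      · exact ⟨y, x, z, hxy.symm, hyz, hxz, h, by omega, by omega, my, mx, mz⟩
      · exact ⟨z, x, y, hxz.symm, hyz.symm, hxy, h, by omega, by omega, mz, mx, my⟩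
    have bP : ∀ x ∈ Z, ∀ q, q ∉ Z → b x q = 0 := by
      intro x hx q hq
      have h1 := bZsum x
      have h2 := bsplit x
      rw [card_erase_of_mem hx] at h1
      have := (mZ x).1 hx
      have h3 := single_le_sum (f := fun q => b x q) (fun _ _ => Nat.zero_le _) (mem_compl.2 hq)
      omega
    have bZ1 : ∀ x ∈ Z, ∀ y ∈ Z, x ≠ y → b x y ≤ 1 := by
      intro x hx y hy hxy
      have h2 := bsplit x
      have ax := (mZ x).1 hx
      have hy' : y ∈ Z.erase x := mem_erase.2 ⟨hxy.symm, hy⟩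
      have e1 : ∑ y ∈ Z.erase x, b x y ≤ ∑ y ∈ Z, b x y :=
        sum_le_sum_of_subset (erase_subset _ _)
      rw [← add_sum_erase _ _ hy'] at e1
      have e2 : ((Z.erase x).erase y).card ≤ ∑ y ∈ (Z.erase x).erase y, b x y := by
        rw [card_eq_sum_ones]
        apply sum_le_sum
        intro w hw
        simp only [mem_erase] at hw
        exact bZ x w hw.2.2 hw.2.1
      rw [card_erase_of_mem hy', card_erase_of_mem hx] at e2
      omega
    have hcc : ∀ x ∈ Z, ∀ y ∈ Z, x ≠ y → ∀ q, q ∉ Z → a q = r + 1 → 1 ≤ c x y q + c y x q := by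
      intro x hx y hy hxy q hq haq
      have := h2 q x y (by rintro rfl; exact hq hx) (by rintro rfl; exact hq hy) hxy
      have := bP x hx q hq
      have := bP y hy q hq
      omega
    have hthird : ∀ i, F i ∈ Z → G i ∈ Z → H i = p ∨ H i = p' := by
      intro i hx hy
      by_contra hne
      push Not at hne
      have hxy := hFG i
      have e1 := bZ1 _ hx _ hy hxy
      have e2 := bZ1 _ hy _ hx hxy.symm
      have e3 := hcc _ hx _ hy hxy p hPm.2.1 ap
      have e4 := hcc _ hx _ hy hxy p' hPm.2.2 ap'
      have e5 : 1 ≤ c (F i) (G i) (H i) := by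
        simp only [hc]
        exact card_pos.2 ⟨i, by simp⟩
      have key : ∀ x y, c x y p + c x y p' + c x y (H i) ≤ b x y := by
        intro x y
        rw [← sumc x y]
        have : ∑ z ∈ {p, p', H i}, c x y z ≤ ∑ z, c x y z := sum_le_sum_of_subset (subset_univ _)
        rw [sum_insert (by simp [hp3, hne.1.symm]), sum_pair hne.2.symm] at this
        omega
      have k1 := key (F i) (G i)
      have k2 := key (G i) (F i)
      omega
    obtain ⟨T, hTZ, hT⟩ := exists_subset_card_eq (s := Z) (n := 3) (by omega)
    have hf := h p0 T (fun hh => hPm.1 (hTZ hh)) (by omega)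
    have hsub : (univ.filter (fun i => F i = p0 ∨ (F i ∈ T ∧ (G i = p0 ∨
        (G i ∈ T ∧ (H i = p0 ∨ H i ∈ T)))))) ⊆ univ.filter (fun i => F i = p0) := by
      intro i
      simp only [mem_filter, mem_univ, true_and]
      rintro (h | ⟨hx, h | ⟨hy, h⟩⟩)
      · exact h
      · exfalso
        have e := bP _ (hTZ hx) p0 hPm.1
        simp only [hb, card_eq_zero, filter_eq_empty_iff] at e
        exact e (mem_univ i) ⟨rfl, h⟩
      · exfalso
        rcases hthird i (hTZ hx) (hTZ hy) with h' | h' <;> rw [h'] at h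
        · rcases h with h | h
          · exact hp1 h.symm
          · exact hPm.2.1 (hTZ h)
        · rcases h with h | h
          · exact hp2 h.symm
          · exact hPm.2.2 (hTZ h)
    have := card_le_card hsub
    simp only [ha] at ap0
    omega

/-- For every `s ≥ 3` there is no `((s+1)², s+3, 2s+1)`-suitable core. -/
theorem not_exists_suitableCore_odd
    (s : ℕ) (hs : 3 ≤ s) :
    ¬ ∃ C : Fin ((s + 1) ^ 2) → Equiv.Perm (Fin (s + 3)),
      IsSuitableCore ((s + 1) ^ 2) (s + 3) (2 * s + 1) C := by
  rintro ⟨C, hC⟩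
  refine core_abstract (V := Fin (s + 3)) (I := Fin ((s + 1) ^ 2)) s hs (by simp) (by simp)
    (fun i => C i ⟨0, by omega⟩) (fun i => C i ⟨1, by omega⟩) (fun i => C i ⟨2, by omega⟩)
    (by intro i; simp) ?_ (by intro i; simp) (by intro i; simp)
  intro σ T hσ hT
  have hcard : ((insert σ T)ᶜ : Finset (Fin (s + 3))).card = s + 2 - T.card := by
    rw [Finset.card_compl, Finset.card_insert_of_notMem hσ, Fintype.card_fin]; omega
  have h := hC _ (by omega) σ (insert σ T)ᶜ (by simp) hcard
  refine le_trans (by omega) (h.trans (Finset.card_le_card ?_))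
  intro i hi
  simp only [Finset.mem_filter, Finset.mem_univ, true_and, Finset.mem_compl, Finset.mem_insert,
    not_or] at hi ⊢
  have key : ∀ k : Fin (s + 3), C i k = σ ∨ C i k ∈ T ∨ ((C i).symm σ : ℕ) < k := by
    intro k
    by_cases h1 : C i k = σ
    · exact Or.inl h1
    by_cases h2 : C i k ∈ T
    · exact Or.inr (Or.inl h2)
    have := hi (C i k) ⟨h1, h2⟩
    rw [Equiv.symm_apply_apply] at this
    exact Or.inr (Or.inr this)
  have pos : ∀ k : Fin (s + 3), ((C i).symm σ : ℕ) = k → C i k = σ := by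
    intro k hk
    have : (C i).symm σ = k := Fin.ext hk
    rw [← this, Equiv.apply_symm_apply]
  have k0 := key ⟨0, by omega⟩
  have k1 := key ⟨1, by omega⟩
  have k2 := key ⟨2, by omega⟩
  have p0 := pos ⟨0, by omega⟩
  have p1 := pos ⟨1, by omega⟩
  simp only at k0 k1 k2 p0 p1
  generalize ((C i).symm σ : ℕ) = m at k0 k1 k2 p0 p1
  rcases k0 with h0 | h0 | h0
  · exact Or.inl h0
  · rcases k1 with h1 | h1 | h1
    · exact Or.inr ⟨h0, Or.inl h1⟩
    · rcases k2 with h2 | h2 | h2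
      · exact Or.inr ⟨h0, Or.inr ⟨h1, Or.inl h2⟩⟩
      · exact Or.inr ⟨h0, Or.inr ⟨h1, Or.inr h2⟩⟩
      · rcases (show m = 0 ∨ m = 1 by omega) with hm | hm
        · exact Or.inl (p0 hm)
        · exact Or.inr ⟨h0, Or.inl (p1 hm)⟩
    · exact Or.inl (p0 (by omega))
  · omega
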